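/- Let g_0 ∈ B_6 be the function g_0 = x_1x_2x_3 + x_1x_4x_5 + x_2x_4x_6 + x_3x_5x_6 + x_4x_5x_6. Then for every g_1 ∈ B_6 with deg(g_1) ≤ 2 (i.e., g_1 ∈ RM(2,6)), the nonlinearity satisfies nl(g_0 + g_1) ≤ 22. -/

import Mathlib

open scoped BigOperators

/-- Boolean functions in `n` variables. -/
abbrev BF (n : ℕ) := (Fin n → ZMod 2) → ZMod 2

/-- Hamming distance between two Boolean functions. -/
def hd {n : ℕ} (f g : BF n) : ℕ :=
  (Finset.univ.filter (fun x : Fin n → ZMod 2 => f x ≠ g x)).card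

/-- The Reed--Muller code `RM(r,n)`: Boolean functions given by evaluation of a
multivariate polynomial over `F_2` of total degree at most `r`. -/
def RM (r n : ℕ) : Set (BF n) :=
  {f | ∃ p : MvPolynomial (Fin n) (ZMod 2),
    p.totalDegree ≤ r ∧ ∀ x, f x = MvPolynomial.eval x p}

/-- The `r`-th order nonlinearity of a Boolean function. -/
noncomputable def nl (r : ℕ) {n : ℕ} (f : BF n) : ℕ :=
  sInf {d | ∃ g ∈ RM r n, d = hd f g}

/-- Concatenation `f1 || f2` of two Boolean functions. -/
def concat {n : ℕ} (f1 f2 : BF n) : BF (n + 1) :=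
  fun x => (1 + x (Fin.last n)) * f1 (x ∘ Fin.castSucc)
    + x (Fin.last n) * f2 (x ∘ Fin.castSucc)

/-- A Boolean function is homogeneous quadratic if it is of the form
`∑_{i<j} a_{ij} x_i x_j`. -/
def HomQuad {n : ℕ} (g : BF n) : Prop :=
  ∃ a : Fin n → Fin n → ZMod 2,
    ∀ x, g x = ∑ i : Fin n, ∑ j : Fin n, (if i < j then a i j * x i * x j else 0)

/-- `Fh f r` is the set of homogeneous quadratic functions `g` with `nl(f+g) = r`. -/
def Fh {n : ℕ} (f : BF n) (r : ℕ) : Set (BF n) :=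
  {g | HomQuad g ∧ nl 1 (f + g) = r}

/-- `NFh f r = |Fh f r|`. -/
noncomputable def NFh {n : ℕ} (f : BF n) (r : ℕ) : ℕ := (Fh f r).ncard

/-- The set of 6-variable Boolean functions with nonlinearity 16. -/
def S16 : Set (BF 6) := {f | nl 1 f = 16}

/-- `f1` and `f2` are affine equivalent modulo `RM(r,n)`. -/
def AffEquivMod (r n : ℕ) (f1 f2 : BF n) : Prop :=
  ∃ A : Matrix (Fin n) (Fin n) (ZMod 2), IsUnit A ∧ ∃ b : Fin n → ZMod 2,
    (fun x => f1 x + f2 (A.mulVec x + b)) ∈ RM r n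

def fun1 : BF 6 := fun x => x 0*x 1*x 5 + x 0*x 2*x 4 + x 1*x 2*x 3

def fun2 : BF 6 := fun x => x 0*x 1*x 2*x 3 + x 0*x 1*x 5 + x 0*x 3*x 4 + x 1*x 2*x 4

def fun3 : BF 6 := fun x => x 0*x 1*x 2*x 3 + x 0*x 2*x 4 + x 0*x 3*x 5 + x 1*x 2*x 4
  + x 1*x 2*x 5 + x 1*x 3*x 4

def fun4 : BF 6 := fun x => x 0*x 1*x 2*x 5 + x 0*x 1*x 3*x 4 + x 0*x 2*x 4
  + x 0*x 3*x 4 + x 0*x 3*x 5 + x 1*x 2*x 3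

def fun5 : BF 6 := fun x => x 0*x 1*x 2*x 3*x 4 + x 0*x 2*x 4 + x 0*x 3*x 5
  + x 1*x 2*x 4 + x 1*x 2*x 5 + x 1*x 3*x 4

def fun6 : BF 6 := fun x => x 0*x 1*x 2*x 3*x 4*x 5 + x 0*x 1*x 5 + x 0*x 2*x 4
  + x 1*x 2*x 3

def fun7 : BF 6 := fun x => x 0*x 1*x 2*x 3*x 4*x 5 + x 0*x 1*x 2*x 3 + x 0*x 1*x 5
  + x 0*x 3*x 4 + x 1*x 2*x 4 + x 3*x 4

def fun8 : BF 6 := fun x => x 0*x 1*x 2*x 3*x 4*x 5 + x 0*x 1*x 2*x 3 + x 0*x 2*x 4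
  + x 0*x 3*x 5 + x 1*x 2*x 4 + x 1*x 2*x 5 + x 1*x 3*x 4

def fun9 : BF 6 := fun x => x 0*x 1*x 2*x 3*x 4*x 5 + x 0*x 1*x 2*x 5 + x 0*x 1*x 3*x 4
  + x 0*x 2*x 4 + x 0*x 3*x 4 + x 0*x 3*x 5 + x 1*x 2*x 3 + x 3*x 5

def fun10 : BF 6 := fun x => x 0*x 1*x 2*x 3*x 4*x 5 + x 0*x 1*x 2*x 3 + x 0*x 2*x 3
  + x 0*x 4*x 5 + x 1*x 2*x 3 + x 1*x 2*x 5 + x 1*x 3*x 4 + x 2*x 3 + x 2*x 5 + x 3*x 4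

def fun11 : BF 6 := fun x => x 0*x 1*x 2*x 3*x 4*x 5 + x 0*x 1*x 2*x 5 + x 0*x 1*x 3*x 4
  + x 0*x 2*x 4 + x 0*x 3*x 4 + x 0*x 3*x 5 + x 1*x 2*x 3 + x 1*x 2*x 5 + x 1*x 3*x 4
  + x 2*x 4 + x 3*x 4 + x 3*x 5

def fun12 : BF 6 := fun x => x 0*x 1*x 2*x 3*x 4*x 5 + x 1*x 2*x 3*x 4 + x 0*x 1*x 4*x 5
  + x 0*x 2*x 3*x 5 + x 0*x 1*x 3 + x 0*x 1*x 4 + x 1*x 2*x 4 + x 2*x 3*x 4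
  + x 0*x 1*x 5 + x 2*x 3*x 5

def g0 : BF 6 := fun x => x 0*x 1*x 2 + x 0*x 3*x 4 + x 1*x 3*x 5 + x 2*x 4*x 5
  + x 3*x 4*x 5


/-- The function `x ↦ l · x + b`. -/
def affineFun {n : ℕ} (l : Fin n → ZMod 2) (b : ZMod 2) : BF n :=
  fun x => ∑ i, l i * x i + b

theorem affineFun_mem_RM {n : ℕ} (l : Fin n → ZMod 2) (b : ZMod 2) :
    affineFun l b ∈ RM 1 n := by
  refine ⟨∑ i, MvPolynomial.C (l i) * MvPolynomial.X i + MvPolynomial.C b, ?_, ?_⟩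
  · refine (MvPolynomial.totalDegree_add _ _).trans (max_le ?_ (by simp))
    refine MvPolynomial.totalDegree_finsetSum_le fun i _ => ?_
    refine (MvPolynomial.totalDegree_mul _ _).trans ?_
    simp
  · intro x
    simp [affineFun]

theorem affineFun_add {n : ℕ} (l l' : Fin n → ZMod 2) (b b' : ZMod 2) :
    affineFun l b + affineFun l' b' = affineFun (l + l') (b + b') := by
  funext x
  simp only [affineFun, Pi.add_apply, add_mul, Finset.sum_add_distrib]
  ring

theorem affineFun_comp_add {n : ℕ} (l a : Fin n → ZMod 2) (b : ZMod 2) :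
    (fun x => affineFun l b (x + a)) = affineFun l (∑ i, l i * a i + b) := by
  funext x
  simp only [affineFun, Pi.add_apply, mul_add, Finset.sum_add_distrib]
  ring

/-- Every function of degree at most two is a quadratic form plus an affine function. -/
theorem exists_quadratic_of_mem_RM_two {n : ℕ} {g : BF n} (hg : g ∈ RM 2 n) :
    ∃ (C : Fin n → Fin n → ZMod 2) (l : Fin n → ZMod 2) (b : ZMod 2),
      ∀ x, g x = ∑ i, ∑ j, C i j * (x i * x j) + affineFun l b x := by
  obtain ⟨p, hp, hgp⟩ := hg
  suffices h : ∀ s ⊆ p.support, ∃ (C : Fin n → Fin n → ZMod 2) (l : Fin n → ZMod 2) (b : ZMod 2),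
      ∀ x : Fin n → ZMod 2, ∑ d ∈ s, p.coeff d * ∏ i, x i ^ d i =
        ∑ i, ∑ j, C i j * (x i * x j) + affineFun l b x by
    simpa only [hgp, MvPolynomial.eval_eq'] using h _ subset_rfl
  intro s
  induction s using Finset.induction_on with
  | empty => exact fun _ => ⟨0, 0, 0, fun x => by simp [affineFun]⟩
  | insert d s hd ih =>
    intro hs
    obtain ⟨C, l, b, h⟩ := ih ((Finset.subset_insert _ _).trans hs)
    suffices hm : ∃ (C' : Fin n → Fin n → ZMod 2) (l' : Fin n → ZMod 2) (b' : ZMod 2),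
        ∀ x : Fin n → ZMod 2, p.coeff d * ∏ i, x i ^ d i =
          ∑ i, ∑ j, C' i j * (x i * x j) + affineFun l' b' x by
      obtain ⟨C', l', b', h'⟩ := hm
      refine ⟨C' + C, l' + l, b' + b, fun x => ?_⟩
      rw [Finset.sum_insert hd, h, h', ← affineFun_add]
      simp only [Pi.add_apply, add_mul, Finset.sum_add_distrib]
      ring
    have hdeg : d.degree ≤ 2 := by
      rw [Finsupp.degree_eq_sum]
      have := (MvPolynomial.le_totalDegree (hs (Finset.mem_insert_self d s))).trans hp
      rwa [Finsupp.sum_fintype _ _ (fun _ => rfl)] at this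
    have hsplit : ∀ e : Fin n →₀ ℕ, e ≠ 0 → ∃ i e', e = Finsupp.single i 1 + e' := by
      intro e he
      obtain ⟨i, hi⟩ := Finsupp.ne_iff.mp he
      refine ⟨i, e - Finsupp.single i 1, (add_tsub_cancel_of_le ?_).symm⟩
      exact Finsupp.single_le_iff.mpr (Nat.one_le_iff_ne_zero.mpr hi)
    have hprod : ∀ (x : Fin n → ZMod 2) (i : Fin n) (e : Fin n →₀ ℕ),
        ∏ k, x k ^ (Finsupp.single i 1 + e : Fin n →₀ ℕ) k = x i * ∏ k, x k ^ e k := by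
      intro x i e
      simp only [Finsupp.add_apply, pow_add, Finset.prod_mul_distrib, Finsupp.single_apply,
        pow_ite, pow_one, pow_zero, Finset.prod_ite_eq, Finset.mem_univ, if_true]
    by_cases h0 : d = 0
    · exact ⟨0, 0, p.coeff d, fun x => by simp [h0, affineFun]⟩
    obtain ⟨i, e, rfl⟩ := hsplit d h0
    generalize p.coeff (Finsupp.single i 1 + e) = c
    by_cases h1 : e = 0
    · refine ⟨0, Pi.single i c, 0, fun x => ?_⟩
      rw [hprod, h1]
      simp [affineFun, Pi.single_apply]
    obtain ⟨j, e, rfl⟩ := hsplit e h1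
    have h2 : e = 0 := by
      rw [← Finsupp.degree_eq_zero_iff]
      simp only [map_add, Finsupp.degree_single] at hdeg
      omega
    refine ⟨fun k m => if k = i then if m = j then c else 0 else 0, 0, 0, fun x => ?_⟩
    rw [hprod, hprod, h2]
    simp [affineFun, Finset.sum_ite_irrel]

theorem hd_translate {n : ℕ} (f g : BF n) (a : Fin n → ZMod 2) :
    hd (fun x => f (x + a)) (fun x => g (x + a)) = hd f g :=
  Finset.card_equiv (Equiv.addRight a) (by simp)

theorem hd_add_right {n : ℕ} (f g h : BF n) : hd (f + h) (g + h) = hd f g := by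
  simp [hd]

/-- `f` has an affine function within distance `22`. -/
def NearAffine {n : ℕ} (f : BF n) : Prop := ∃ l b, hd f (affineFun l b) ≤ 22

theorem NearAffine.nl_le {n : ℕ} {f : BF n} (h : NearAffine f) : nl 1 f ≤ 22 := by
  obtain ⟨l, b, h⟩ := h
  exact le_trans (Nat.sInf_le ⟨affineFun l b, affineFun_mem_RM l b, rfl⟩) h

theorem NearAffine.of_add_affineFun {n : ℕ} {f : BF n} {l : Fin n → ZMod 2} {b : ZMod 2}
    (h : NearAffine (f + affineFun l b)) : NearAffine f := by
  obtain ⟨l', b', h⟩ := h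
  refine ⟨l' + l, b' + b, ?_⟩
  rw [← hd_add_right _ _ (affineFun l b), ← affineFun_add, add_assoc, CharTwo.add_self_eq_zero,
    add_zero]
  exact h

theorem NearAffine.of_translate {n : ℕ} {f : BF n} (a : Fin n → ZMod 2)
    (h : NearAffine fun x => f (x + a)) : NearAffine f := by
  obtain ⟨l, b, h⟩ := h
  refine ⟨l, ∑ i, l i * a i + b, ?_⟩
  rw [← hd_translate _ _ a, affineFun_comp_add]
  convert h using 3
  rw [← add_assoc, CharTwo.add_self_eq_zero, zero_add]

/-- Position of a point of the cube in a truth table. -/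
def pointIndex : (Fin 6 → ZMod 2) ≃ Fin 64 := finFunctionFinEquiv

/-- The binary digits of `t` are the truth table of `f`. -/
def IsTable (t : ℕ) (f : BF 6) : Prop :=
  ∀ x, f x = if t.testBit (pointIndex x) then 1 else 0

instance (t : ℕ) (f : BF 6) : Decidable (IsTable t f) :=
  inferInstanceAs (Decidable (∀ _, _))

theorem IsTable.xor {s t : ℕ} {f g : BF 6} (hf : IsTable s f) (hg : IsTable t g) :
    IsTable (s ^^^ t) (f + g) := by
  intro x
  rw [Pi.add_apply, hf, hg, Nat.testBit_xor]
  cases s.testBit (pointIndex x) <;> cases t.testBit (pointIndex x) <;> decide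

/-- The number of ones among the lowest `n` binary digits of `t`. The recursor and the kernel's
accelerated operations appear directly, to keep evaluation in the kernel fast. -/
def bitWeight (t n : ℕ) : ℕ :=
  Nat.rec 0 (fun k w => Nat.add w (Nat.mod (Nat.shiftRight t k) 2)) n

theorem bitWeight_succ (t n : ℕ) : bitWeight t (n + 1) = bitWeight t n + (t >>> n) % 2 := rfl

theorem bitWeight_eq_card (t n : ℕ) :
    bitWeight t n = (Finset.univ.filter fun k : Fin n => t.testBit k).card := by
  rw [Finset.card_filter]
  induction n with
  | zero => rfl
  | succ n ih =>
    rw [Fin.sum_univ_castSucc, bitWeight_succ, ih, Nat.shiftRight_eq_div_pow]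
    simp only [Fin.val_castSucc, Fin.val_last, Nat.testBit_eq_decide_div_mod_eq, decide_eq_true_eq]
    split_ifs <;> omega

theorem IsTable.hd_zero {t : ℕ} {f : BF 6} (hf : IsTable t f) : hd f 0 = bitWeight t 64 := by
  rw [bitWeight_eq_card]
  exact Finset.card_equiv pointIndex (by simp [hf _])

/-- Whether some sum of `t` with elements of the list has weight at most `22`. -/
def someSumLight : List ℕ → ℕ → Bool
  | [], t => Nat.ble (bitWeight t 64) 22
  | m :: ms, t => someSumLight ms t || someSumLight ms (t ^^^ m)

/-- Whether all sums of `t` with elements of the second list satisfy `someSumLight` with respect to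
the first list. -/
def allSumsLight (ls : List ℕ) : List ℕ → ℕ → Bool
  | [], t => someSumLight ls t
  | m :: ms, t => allSumsLight ls ms t && allSumsLight ls ms (t ^^^ m)

theorem nearAffine_of_someSumLight {ls : List ℕ}
    (hls : ∀ m ∈ ls, ∃ l b, IsTable m (affineFun l b)) {t : ℕ} {f : BF 6} (hf : IsTable t f)
    (h : someSumLight ls t = true) : NearAffine f := by
  induction ls generalizing t f with
  | nil =>
    refine ⟨0, 0, ?_⟩
    have h0 : (affineFun 0 0 : BF 6) = 0 := by funext x; simp [affineFun]
    rw [h0, hf.hd_zero]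
    exact Nat.le_of_ble_eq_true h
  | cons m ms ih =>
    rw [List.forall_mem_cons] at hls
    rw [someSumLight, Bool.or_eq_true] at h
    obtain ⟨l, b, hm⟩ := hls.1
    rcases h with h | h
    · exact ih hls.2 hf h
    · exact (ih hls.2 (hf.xor hm) h).of_add_affineFun

theorem exists_allSumsLight_of_cons {ls ms : List ℕ} {m : ℕ} {f g : BF 6}
    (h : ∃ t, IsTable t f ∧ allSumsLight ls (m :: ms) t = true) (hg : IsTable m g) (c : ZMod 2) :
    ∃ t, IsTable t (f + c • g) ∧ allSumsLight ls ms t = true := by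
  obtain ⟨t, hf, h⟩ := h
  rw [allSumsLight, Bool.and_eq_true] at h
  rcases (by decide : ∀ c : ZMod 2, c = 0 ∨ c = 1) c with rfl | rfl
  · exact ⟨t, by simpa using hf, h.1⟩
  · exact ⟨t ^^^ m, by simpa using hf.xor hg, h.2⟩

/-- The truth tables of the coordinates and of the constant `1`. -/
def affineTables : List ℕ :=
  [12297829382473034410, 14757395258967641292, 17361641481138401520,
    18374966859414961920, 18446462603027742720, 18446744069414584320,
    18446744073709551615]

theorem exists_affineFun_of_mem_affineTables :
    ∀ m ∈ affineTables, ∃ l b, IsTable m (affineFun l b) := by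
  simp only [affineTables, List.forall_mem_cons]
  exact ⟨⟨Pi.single 0 1, 0, by decide +kernel⟩,
    ⟨Pi.single 1 1, 0, by decide +kernel⟩,
    ⟨Pi.single 2 1, 0, by decide +kernel⟩,
    ⟨Pi.single 3 1, 0, by decide +kernel⟩,
    ⟨Pi.single 4 1, 0, by decide +kernel⟩,
    ⟨Pi.single 5 1, 0, by decide +kernel⟩,
    ⟨0, 1, by decide +kernel⟩, by simp⟩

/-- The truth tables of nine products of two coordinates. -/
def quadraticTables : List ℕ :=
  [12297829379609722880, 14757170082422194176, 14757395255531667456,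
    17294086455919964160, 17361376567555522560, 17361641477096079360,
    18374686483949813760, 18374966855136706560, 18446462598732840960]

theorem allSumsLight_g0 :
    allSumsLight affineTables quadraticTables 16821028721581392000 = true := by
  decide +kernel

theorem isTable_g0 : IsTable 16821028721581392000 g0 := by
  decide +kernel

/-- Representatives of `g0 + RM(2,6)` modulo translations and affine functions. -/
theorem nearAffine_g0_add (c : Fin 9 → ZMod 2) :
    NearAffine (g0 
      + c 0 • (fun x => x 0 * x 5) + c 1 • (fun x => x 1 * x 4) + c 2 • (fun x => x 1 * x 5)
      + c 3 • (fun x => x 2 * x 3) + c 4 • (fun x => x 2 * x 4) + c 5 • (fun x => x 2 * x 5)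
      + c 6 • (fun x => x 3 * x 4) + c 7 • (fun x => x 3 * x 5) + c 8 • (fun x => x 4 * x 5)) := by
  have h : ∃ t, IsTable t g0 ∧ allSumsLight affineTables quadraticTables t = true :=
    ⟨_, isTable_g0, allSumsLight_g0⟩
  replace h := exists_allSumsLight_of_cons (g := fun x => x 0 * x 5) h (by decide +kernel) (c 0)
  replace h := exists_allSumsLight_of_cons (g := fun x => x 1 * x 4) h (by decide +kernel) (c 1)
  replace h := exists_allSumsLight_of_cons (g := fun x => x 1 * x 5) h (by decide +kernel) (c 2)
  replace h := exists_allSumsLight_of_cons (g := fun x => x 2 * x 3) h (by decide +kernel) (c 3)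
  replace h := exists_allSumsLight_of_cons (g := fun x => x 2 * x 4) h (by decide +kernel) (c 4)
  replace h := exists_allSumsLight_of_cons (g := fun x => x 2 * x 5) h (by decide +kernel) (c 5)
  replace h := exists_allSumsLight_of_cons (g := fun x => x 3 * x 4) h (by decide +kernel) (c 6)
  replace h := exists_allSumsLight_of_cons (g := fun x => x 3 * x 5) h (by decide +kernel) (c 7)
  replace h := exists_allSumsLight_of_cons (g := fun x => x 4 * x 5) h (by decide +kernel) (c 8)
  obtain ⟨t, ht, h⟩ := h
  exact nearAffine_of_someSumLight exists_affineFun_of_mem_affineTables ht h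

/-- Modulo affine functions, translation by `a` adds `∑ i, a i • ∂ᵢ g0` to `g0`. -/
theorem g0_translate (x a : Fin 6 → ZMod 2) :
    g0 (x + a) = g0 x + a 0 * (x 1 * x 2 + x 3 * x 4) + a 1 * (x 0 * x 2 + x 3 * x 5)
      + a 2 * (x 0 * x 1 + x 4 * x 5) + a 3 * (x 0 * x 4 + x 1 * x 5 + x 4 * x 5)
      + a 4 * (x 0 * x 3 + x 2 * x 5 + x 3 * x 5) + a 5 * (x 1 * x 3 + x 2 * x 4 + x 3 * x 4)
      + affineFun ![a 1 * a 2 + a 3 * a 4, a 0 * a 2 + a 3 * a 5, a 0 * a 1 + a 4 * a 5,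
          a 0 * a 4 + a 1 * a 5 + a 4 * a 5, a 0 * a 3 + a 2 * a 5 + a 3 * a 5,
          a 1 * a 3 + a 2 * a 4 + a 3 * a 4] (g0 a) x := by
  simp only [g0, affineFun, Fin.sum_univ_six, Pi.add_apply, Matrix.cons_val]
  ring

theorem quadraticForm_translate {n : ℕ} (C : Fin n → Fin n → ZMod 2) (x a : Fin n → ZMod 2) :
    ∑ i, ∑ j, C i j * ((x + a) i * (x + a) j) = ∑ i, ∑ j, C i j * (x i * x j)
      + affineFun (fun i => ∑ j, (C i j + C j i) * a j) (∑ i, ∑ j, C i j * (a i * a j)) x := by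
  have h : ∑ i, ∑ j, C j i * a j * x i = ∑ i, ∑ j, C i j * a i * x j := Finset.sum_comm
  simp only [affineFun, Pi.add_apply, add_mul, mul_add, Finset.sum_add_distrib, Finset.sum_mul, h]
  simp only [← mul_assoc, mul_right_comm _ (a _) (x _)]
  ring

theorem quadraticForm_six (C : Fin 6 → Fin 6 → ZMod 2) (x : Fin 6 → ZMod 2) :
    ∑ i, ∑ j, C i j * (x i * x j) =
      (C 0 1 + C 1 0) * (x 0 * x 1) + (C 0 2 + C 2 0) * (x 0 * x 2)
      + (C 0 3 + C 3 0) * (x 0 * x 3) + (C 0 4 + C 4 0) * (x 0 * x 4)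
      + (C 0 5 + C 5 0) * (x 0 * x 5) + (C 1 2 + C 2 1) * (x 1 * x 2)
      + (C 1 3 + C 3 1) * (x 1 * x 3) + (C 1 4 + C 4 1) * (x 1 * x 4)
      + (C 1 5 + C 5 1) * (x 1 * x 5) + (C 2 3 + C 3 2) * (x 2 * x 3)
      + (C 2 4 + C 4 2) * (x 2 * x 4) + (C 2 5 + C 5 2) * (x 2 * x 5)
      + (C 3 4 + C 4 3) * (x 3 * x 4) + (C 3 5 + C 5 3) * (x 3 * x 5)
      + (C 4 5 + C 5 4) * (x 4 * x 5) + affineFun (fun i => C i i) 0 x := by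
  have h : ∀ y : ZMod 2, y * y = y := by decide
  simp only [affineFun, Fin.sum_univ_six, h]
  ring

/-- For every `g1 ∈ RM(2,6)`, `nl(g0 + g1) ≤ 22`. -/
theorem stmt18 : ∀ g1 ∈ RM 2 6, nl 1 (g0 + g1) ≤ 22 := by
  intro g1 hg1
  obtain ⟨C, l, b, hg⟩ := exists_quadratic_of_mem_RM_two hg1
  set a : Fin 6 → ZMod 2 := ![C 1 2 + C 2 1, C 0 2 + C 2 0, C 0 1 + C 1 0, C 0 4 + C 4 0,
    C 0 3 + C 3 0, C 1 3 + C 3 1] with ha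
  have h := nearAffine_g0_add ![C 0 5 + C 5 0, C 1 4 + C 4 1, C 1 5 + C 5 1 + a 3, C 2 3 + C 3 2,
    C 2 4 + C 4 2 + a 5, C 2 5 + C 5 2 + a 4, C 3 4 + C 4 3 + a 0 + a 5,
    C 3 5 + C 5 3 + a 1 + a 4, C 4 5 + C 5 4 + a 2 + a 3]
  refine (NearAffine.of_translate a (NearAffine.of_add_affineFun (l := ![a 1 * a 2 + a 3 * a 4,
    a 0 * a 2 + a 3 * a 5, a 0 * a 1 + a 4 * a 5, a 0 * a 4 + a 1 * a 5 + a 4 * a 5,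
    a 0 * a 3 + a 2 * a 5 + a 3 * a 5, a 1 * a 3 + a 2 * a 4 + a 3 * a 4]
      + ((fun i => ∑ j, (C i j + C j i) * a j) + ((fun i => C i i) + l)))
    (b := g0 a + (∑ i, ∑ j, C i j * (a i * a j) + (0 + (∑ i, l i * a i + b)))) ?_)).nl_le
  convert h using 1
  funext x
  have hl : affineFun l b (x + a) = affineFun l (∑ i, l i * a i + b) x :=
    congrFun (affineFun_comp_add l a b) x
  have h2 : (2 : ZMod 2) = 0 := rfl
  have hf : (g0 + g1) (x + a) = g0 (x + a) + g1 (x + a) := rfl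
  rw [← affineFun_add, ← affineFun_add, ← affineFun_add, Pi.add_apply, hf, hg, g0_translate,
    quadraticForm_translate, hl, quadraticForm_six]
  simp only [Pi.add_apply, Pi.smul_apply, smul_eq_mul, Matrix.cons_val]
  generalize affineFun (fun i => C i i) 0 x = A₁
  generalize affineFun l _ x = A₂
  generalize affineFun (fun i => ∑ j, (C i j + C j i) * a j) _ x = A₃
  generalize affineFun ![_, _, _, _, _, _] _ x = A₄
  simp only [ha, Matrix.cons_val]
  linear_combination (A₁ + A₂ + A₃ + A₄ + (C 1 2 + C 2 1) * (x 1 * x 2)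
    + (C 0 2 + C 2 0) * (x 0 * x 2) + (C 0 1 + C 1 0) * (x 0 * x 1) + (C 0 4 + C 4 0) * (x 0 * x 4)
    + (C 0 3 + C 3 0) * (x 0 * x 3) + (C 1 3 + C 3 1) * (x 1 * x 3)) * h2
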